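/- Let n ≥ 1 and let u : ℝⁿ → ℝ be C¹ on ℝⁿ and C³ on {|∇u| > 0}, satisfying div(∇u/√(1+|∇u|²)) = |∇u|/√(1+|∇u|²) on all of ℝⁿ. If u(x) = o(|x|^{1/3}) as |x| → ∞ (i.e. |u(x)|/|x|^{1/3} → 0 as |x| → ∞), then u is constant. -/

import Mathlib

open Metric Real Filter

noncomputable def pd1 {n : ℕ} (u : EuclideanSpace ℝ (Fin n) → ℝ) (i : Fin n)
    (x : EuclideanSpace ℝ (Fin n)) : ℝ :=
  fderiv ℝ u x (EuclideanSpace.single i 1)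

noncomputable def pd2 {n : ℕ} (u : EuclideanSpace ℝ (Fin n) → ℝ) (i j : Fin n)
    (x : EuclideanSpace ℝ (Fin n)) : ℝ :=
  fderiv ℝ (pd1 u j) x (EuclideanSpace.single i 1)

/-- The coefficients `a^{ij} = δ^{ij} - u_i u_j / (1 + |∇u|²)` of the
nondivergence form of the mean curvature operator. -/
noncomputable def aCoef {n : ℕ} (u : EuclideanSpace ℝ (Fin n) → ℝ) (i j : Fin n)
    (x : EuclideanSpace ℝ (Fin n)) : ℝ :=
  (if i = j then (1 : ℝ) else 0) - pd1 u i x * pd1 u j x / (1 + ‖gradient u x‖ ^ 2)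

/-- The mean curvature operator in nondivergence form: `a^{ij} u_{ij}`. -/
noncomputable def mcOp {n : ℕ} (u : EuclideanSpace ℝ (Fin n) → ℝ)
    (x : EuclideanSpace ℝ (Fin n)) : ℝ :=
  ∑ i, ∑ j, aCoef u i j x * pd2 u i j x

open scoped Topology

/-- Second derivative test at a local maximum. -/
lemma second_deriv_nonpos_of_isLocalMax {f f' : ℝ → ℝ} {c t₀ : ℝ}
    (hf : ∀ᶠ t in 𝓝 t₀, HasDerivAt f (f' t) t) (hf' : HasDerivAt f' c t₀)
    (hmax : IsLocalMax f t₀) : c ≤ 0 := by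
  by_contra! hc
  have hd : deriv f =ᶠ[𝓝 t₀] f' := hf.mono fun t ht => ht.deriv
  have hdd : deriv (deriv f) t₀ = c := by rw [hd.deriv_eq, hf'.deriv]
  have hmin : IsLocalMin f t₀ :=
    isLocalMin_of_deriv_deriv_pos (hdd ▸ hc) hmax.deriv_eq_zero
      hf.self_of_nhds.continuousAt
  have hconst : f =ᶠ[𝓝 t₀] fun _ => f t₀ := by
    filter_upwards [hmin, hmax] with t h1 h2 using le_antisymm h2 h1
  have hzero : deriv f =ᶠ[𝓝 t₀] fun _ => 0 := by
    refine hconst.deriv.trans ?_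
    simp
  have : deriv (deriv f) t₀ = 0 := by rw [hzero.deriv_eq]; simp
  linarith

/-- Contracting the matrix `I - p pᵀ / (1 + |p|²)` with a negative semidefinite matrix
gives a nonpositive number. -/
lemma sum_coef_mul_nonpos {ι : Type*} [Fintype ι] [DecidableEq ι] (W : ι → ι → ℝ) (p : ι → ℝ)
    (hW : ∀ i j a b, a * a * W i i + a * b * (W i j + W j i) + b * b * W j j ≤ 0) :
    ∑ i, ∑ j, ((if i = j then (1 : ℝ) else 0) - p i * p j / (1 + ∑ k, p k ^ 2)) * W i j ≤ 0 := by
  set P := ∑ k, p k ^ 2 with hP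
  have hP0 : 0 ≤ P := Finset.sum_nonneg fun k _ => sq_nonneg _
  have hT : ∑ i, W i i ≤ 0 := Finset.sum_nonpos fun i _ => by simpa using hW i i 1 0
  have hS : ∑ i, ∑ j, (p j * p j * W i i + p j * (-p i) * (W i j + W j i)
      + (-p i) * (-p i) * W j j) ≤ 0 :=
    Finset.sum_nonpos fun i _ => Finset.sum_nonpos fun j _ => hW i j (p j) (-p i)
  have e1 : ∑ i, ∑ j, p j * p j * W i i = P * ∑ i, W i i := by
    rw [Finset.mul_sum]
    refine Finset.sum_congr rfl fun i _ => ?_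
    rw [hP, Finset.sum_mul]
    exact Finset.sum_congr rfl fun j _ => by ring
  have e2 : ∑ i, ∑ j, (-p i) * (-p i) * W j j = P * ∑ i, W i i := by
    rw [Finset.sum_comm, ← e1]
    exact Finset.sum_congr rfl fun i _ => Finset.sum_congr rfl fun j _ => by ring
  have e3 : ∑ i, ∑ j, p i * p j * W j i = ∑ i, ∑ j, p i * p j * W i j := by
    rw [Finset.sum_comm]
    exact Finset.sum_congr rfl fun i _ => Finset.sum_congr rfl fun j _ => by ring
  have e4 : ∑ i, ∑ j, p j * (-p i) * (W i j + W j i) = -2 * ∑ i, ∑ j, p i * p j * W i j := by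
    have : ∑ i, ∑ j, p j * (-p i) * (W i j + W j i)
        = -(∑ i, ∑ j, p i * p j * W i j) - ∑ i, ∑ j, p i * p j * W j i := by
      rw [← Finset.sum_neg_distrib, ← Finset.sum_sub_distrib]
      refine Finset.sum_congr rfl fun i _ => ?_
      rw [← Finset.sum_neg_distrib, ← Finset.sum_sub_distrib]
      exact Finset.sum_congr rfl fun j _ => by ring
    rw [this, e3]; ring
  simp only [Finset.sum_add_distrib] at hS
  rw [e1, e2, e4] at hS
  have e5 : ∑ i, ∑ j, ((if i = j then (1 : ℝ) else 0) - p i * p j / (1 + P)) * W i j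
      = ∑ i, W i i - (∑ i, ∑ j, p i * p j * W i j) / (1 + P) := by
    rw [Finset.sum_div, ← Finset.sum_sub_distrib]
    refine Finset.sum_congr rfl fun i _ => ?_
    simp only [sub_mul, Finset.sum_sub_distrib, ite_mul, one_mul, zero_mul, Finset.sum_ite_eq,
      Finset.mem_univ, if_true, Finset.sum_div]
    congr 1
    exact Finset.sum_congr rfl fun j _ => by ring
  rw [e5, sub_nonpos, le_div_iff₀ (by positivity)]
  linarith

/-- The profile of the radial barrier, as a function of the squared radius. -/
noncomputable def barrier (n : ℕ) (s : ℝ) : ℝ :=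
  s - ((n : ℝ) + 1) ^ (2 * n + 2) * s ^ (-(n : ℤ))

/-- The derivative of `barrier`. -/
noncomputable def barrierDeriv (n : ℕ) (s : ℝ) : ℝ :=
  1 + n * ((n : ℝ) + 1) ^ (2 * n + 2) * s ^ (-(n : ℤ) - 1)

/-- The second derivative of `barrier`. -/
noncomputable def barrierDeriv2 (n : ℕ) (s : ℝ) : ℝ :=
  -(n * (n + 1) * ((n : ℝ) + 1) ^ (2 * n + 2) * s ^ (-(n : ℤ) - 2))

lemma hasDerivAt_barrier (n : ℕ) {s : ℝ} (hs : 0 < s) :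
    HasDerivAt (barrier n) (barrierDeriv n s) s := by
  have h := (hasDerivAt_id s).sub
    ((hasDerivAt_zpow (-(n : ℤ)) s (Or.inl hs.ne')).const_mul (((n : ℝ) + 1) ^ (2 * n + 2)))
  refine h.congr_deriv ?_
  simp only [barrierDeriv]
  push_cast
  ring

lemma hasDerivAt_barrierDeriv (n : ℕ) {s : ℝ} (hs : 0 < s) :
    HasDerivAt (barrierDeriv n) (barrierDeriv2 n s) s := by
  have h := ((hasDerivAt_zpow (-(n : ℤ) - 1) s (Or.inl hs.ne')).const_mul
    (n * ((n : ℝ) + 1) ^ (2 * n + 2))).const_add 1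
  refine h.congr_deriv ?_
  rw [barrierDeriv2, show (-(n : ℤ) - 1 - 1) = -(n : ℤ) - 2 by ring]
  push_cast
  ring

lemma one_le_barrierDeriv (n : ℕ) {s : ℝ} (hs : 0 < s) : 1 ≤ barrierDeriv n s := by
  have : 0 ≤ n * ((n : ℝ) + 1) ^ (2 * n + 2) * s ^ (-(n : ℤ) - 1) := by positivity
  rw [barrierDeriv]
  linarith

lemma barrierDeriv_anti (n : ℕ) {s t : ℝ} (hs : 0 < s) (hst : s ≤ t) :
    barrierDeriv n t ≤ barrierDeriv n s := by
  have h : t ^ (-(n : ℤ) - 1) ≤ s ^ (-(n : ℤ) - 1) := by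
    rw [show (-(n : ℤ) - 1) = -((n + 1 : ℕ) : ℤ) by push_cast; ring, zpow_neg, zpow_neg,
      zpow_natCast, zpow_natCast]
    gcongr
  simp only [barrierDeriv]
  gcongr

/-- A small multiple of the radial barrier is a strict supersolution. -/
lemma barrier_strict_supersolution {n : ℕ} (hn : 1 ≤ n) {ρ δ r : ℝ} (hρ : 0 < ρ) (hδ : 0 < δ)
    (hδρ : 2 * δ * barrierDeriv n (ρ ^ 2) * (n + 1) ≤ 1) (hr : ρ ≤ r) :
    2 * ((n : ℝ) - 1) * barrierDeriv n (r ^ 2) +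
      (2 * barrierDeriv n (r ^ 2) + 4 * barrierDeriv2 n (r ^ 2) * r ^ 2) /
        (1 + (2 * δ * barrierDeriv n (r ^ 2) * r) ^ 2) < 2 * barrierDeriv n (r ^ 2) * r := by
  have hr0 : 0 < r := hρ.trans_le hr
  have hn' : (1 : ℝ) ≤ n := by exact_mod_cast hn
  set X := ((n : ℝ) + 1) ^ (2 * n + 2) * (r ^ 2) ^ (-(n : ℤ) - 1) with hX
  have hX0 : 0 < X := by positivity
  have h1 : barrierDeriv n (r ^ 2) = 1 + n * X := by rw [barrierDeriv, hX]; ring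
  have h2 : barrierDeriv2 n (r ^ 2) * r ^ 2 = -(n * (n + 1) * X) := by
    have : (r ^ 2) ^ (-(n : ℤ) - 2) * r ^ 2 = (r ^ 2) ^ (-(n : ℤ) - 1) := by
      rw [← zpow_add_one₀ (by positivity)]
      congr 1
      ring
    rw [barrierDeriv2, hX, ← this]; ring
  have hG : 0 ≤ barrierDeriv n (r ^ 2) := by rw [h1]; positivity
  rw [mul_assoc 4, h2]
  set D := 1 + (2 * δ * barrierDeriv n (r ^ 2) * r) ^ 2 with hD
  have hD1 : 1 ≤ D := by rw [hD]; nlinarith [sq_nonneg (2 * δ * barrierDeriv n (r ^ 2) * r)]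
  have hD0 : 0 < D := by linarith
  have hnX : 0 < n * X := by positivity
  rcases le_or_gt ((n : ℝ) + 1) r with h | h
  · have : (2 * barrierDeriv n (r ^ 2) + 4 * (-(n * (n + 1) * X))) / D ≤ 2 := by
      rw [div_le_iff₀ hD0, h1]
      nlinarith
    rw [h1] at this ⊢
    nlinarith [mul_le_mul_of_nonneg_left h (by positivity : 0 ≤ 2 * (1 + n * X))]
  · have hX1 : 1 ≤ X := by
      have : (r ^ 2) ^ (-(n : ℤ) - 1) = (r ^ (2 * n + 2))⁻¹ := by
        rw [show (-(n : ℤ) - 1) = -((n + 1 : ℕ) : ℤ) by push_cast; ring, zpow_neg, zpow_natCast,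
          ← pow_mul]
        ring_nf
      rw [hX, this, ← div_eq_mul_inv, one_le_div (by positivity)]
      gcongr
    have hD2 : D ≤ 2 := by
      have hb : 2 * δ * barrierDeriv n (r ^ 2) * r ≤ 1 := by
        refine le_trans ?_ hδρ
        have := barrierDeriv_anti n (s := ρ ^ 2) (t := r ^ 2) (by positivity) (by gcongr)
        have hGρ : 0 ≤ barrierDeriv n (ρ ^ 2) :=
          zero_le_one.trans (one_le_barrierDeriv n (by positivity))
        gcongr
      have hb0 : 0 ≤ 2 * δ * barrierDeriv n (r ^ 2) * r := by positivity
      rw [hD]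
      nlinarith
    have hlt : (2 * barrierDeriv n (r ^ 2) + 4 * (-(n * (n + 1) * X))) / D ≤
        1 - n * (2 * n + 1) * X := by
      rw [div_le_iff₀ hD0, h1]
      have : 0 ≤ n * (2 * n + 1) * X - 1 := by nlinarith
      nlinarith
    rw [h1] at hlt ⊢
    have : 0 < 2 * (1 + n * X) * r := by positivity
    nlinarith

section

variable {n : ℕ}

lemma pd1_eq_gradient {u : EuclideanSpace ℝ (Fin n) → ℝ} {x : EuclideanSpace ℝ (Fin n)}
    (i : Fin n) : pd1 u i x = gradient u x i := by
  rw [pd1, ← toDual_gradient, InnerProductSpace.toDual_apply_apply,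
    EuclideanSpace.inner_single_right]
  simp

lemma hasFDerivAt_radial {G : ℝ → ℝ} {g : ℝ} {x₀ x : EuclideanSpace ℝ (Fin n)}
    (hG : HasDerivAt G g (‖x - x₀‖ ^ 2)) :
    HasFDerivAt (fun z => G (‖z - x₀‖ ^ 2)) ((2 * g) • innerSL ℝ (x - x₀)) x := by
  have h1 : HasFDerivAt (fun z : EuclideanSpace ℝ (Fin n) => ‖z - x₀‖ ^ 2)
      (2 • (innerSL ℝ (x - x₀)).comp (ContinuousLinearMap.id ℝ _)) x :=
    ((hasFDerivAt_id x).sub_const x₀).norm_sq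
  refine (hG.comp_hasFDerivAt x h1).congr_fderiv ?_
  ext v
  simp
  ring

/-- At an interior maximum of `u - δ G(|x - x₀|²)`, the Hessian of `u` is dominated by that of
the radial function. -/
lemma hessian_le_of_isLocalMax {u : EuclideanSpace ℝ (Fin n) → ℝ} {G G' : ℝ → ℝ} {g δ : ℝ}
    {x₀ x : EuclideanSpace ℝ (Fin n)} (hu : ContDiffAt ℝ 2 u x)
    (hG : ∀ᶠ s in 𝓝 (‖x - x₀‖ ^ 2), HasDerivAt G (G' s) s)
    (hG' : HasDerivAt G' g (‖x - x₀‖ ^ 2))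
    (hmax : IsLocalMax (fun z => u z - δ * G (‖z - x₀‖ ^ 2)) x)
    (v : EuclideanSpace ℝ (Fin n)) :
    fderiv ℝ (fderiv ℝ u) x v v ≤
      δ * (4 * g * inner ℝ (x - x₀) v ^ 2 + 2 * G' (‖x - x₀‖ ^ 2) * ‖v‖ ^ 2) := by
  let γ : ℝ → EuclideanSpace ℝ (Fin n) := fun t => x + t • v
  have hγ0 : γ 0 = x := by simp [γ]
  have hγ : ∀ t, HasDerivAt γ v t := fun t => by
    simpa [γ] using ((hasDerivAt_id t).smul_const v).const_add x
  have hγc : Tendsto γ (𝓝 0) (𝓝 x) := by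
    simpa only [hγ0] using (hγ 0).continuousAt.tendsto
  have hsc : Tendsto (fun t => ‖γ t - x₀‖ ^ 2) (𝓝 0) (𝓝 (‖x - x₀‖ ^ 2)) :=
    ((hγc.sub_const x₀).norm).pow 2
  have hdu : ∀ᶠ z in 𝓝 x, DifferentiableAt ℝ u z :=
    (hu.eventually (by simp)).mono fun z hz => hz.differentiableAt (by simp)
  have hdd : DifferentiableAt ℝ (fderiv ℝ u) x :=
    (hu.fderiv_right (m := 1) (by norm_num)).differentiableAt (by simp)
  have key := second_deriv_nonpos_of_isLocalMax (t₀ := 0)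
    (f := fun t => u (γ t) - δ * G (‖γ t - x₀‖ ^ 2))
    (f' := fun t => fderiv ℝ u (γ t) v - δ * (2 * G' (‖γ t - x₀‖ ^ 2) * inner ℝ (γ t - x₀) v))
    (c := fderiv ℝ (fderiv ℝ u) x v v -
      δ * (4 * g * inner ℝ (x - x₀) v ^ 2 + 2 * G' (‖x - x₀‖ ^ 2) * ‖v‖ ^ 2)) ?_ ?_ ?_
  · linarith
  · filter_upwards [hγc.eventually hdu, hsc.eventually hG] with t h1 h2
    have a := h1.hasFDerivAt.comp_hasDerivAt t (hγ t)
    have b := (hasFDerivAt_radial h2).comp_hasDerivAt t (hγ t)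
    refine (a.sub (b.const_mul δ)).congr_deriv ?_
    simp only [smul_apply, innerSL_apply_apply, smul_eq_mul]
  · have a : HasDerivAt (fun t => fderiv ℝ u (γ t) v) (fderiv ℝ (fderiv ℝ u) x v v) 0 := by
      have := hdd.hasFDerivAt
      rw [← hγ0] at this
      have h2 := (this.comp_hasDerivAt 0 (hγ 0)).clm_apply (hasDerivAt_const (0 : ℝ) v)
      simpa [hγ0] using h2
    have b : HasDerivAt (fun t => G' (‖γ t - x₀‖ ^ 2)) (2 * g * inner ℝ (x - x₀) v) 0 := by
      have h1 := hasFDerivAt_radial hG'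
      rw [← hγ0] at h1
      have h2 := h1.comp_hasDerivAt 0 (hγ 0)
      simpa [hγ0, inner_sub_left, Function.comp_def] using h2
    have c : HasDerivAt (fun t => inner ℝ (γ t - x₀) v) (‖v‖ ^ 2) 0 := by
      have := ((hγ 0).sub_const x₀).inner ℝ (hasDerivAt_const (0 : ℝ) v)
      simpa using this
    refine (a.sub (((b.const_mul 2).mul c).const_mul δ)).congr_deriv ?_
    simp only [hγ0]
    ring
  · have : IsLocalMax (fun z => u z - δ * G (‖z - x₀‖ ^ 2)) (γ 0) := by rwa [hγ0]
    exact this.comp_continuous (hγ 0).continuousAt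

/-- A solution cannot be touched from above by a small multiple of the barrier. -/
lemma not_isLocalMax_sub_barrier (hn : 1 ≤ n) {u : EuclideanSpace ℝ (Fin n) → ℝ}
    (hu1 : ContDiff ℝ 1 u) (hu3 : ContDiffOn ℝ 3 u {x | gradient u x ≠ 0})
    (heq : ∀ x, gradient u x ≠ 0 → mcOp u x = ‖gradient u x‖)
    {x₀ x : EuclideanSpace ℝ (Fin n)} {ρ δ : ℝ} (hρ : 0 < ρ) (hδ : 0 < δ)
    (hδρ : 2 * δ * barrierDeriv n (ρ ^ 2) * (n + 1) ≤ 1) (hx : ρ ≤ ‖x - x₀‖) :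
    ¬ IsLocalMax (fun z => u z - δ * barrier n (‖z - x₀‖ ^ 2)) x := by
  intro hmax
  set r := ‖x - x₀‖ with hr
  have hr0 : 0 < r := hρ.trans_le hx
  have hs0 : 0 < r ^ 2 := by positivity
  set G1 := barrierDeriv n (r ^ 2) with hG1
  set G2 := barrierDeriv2 n (r ^ 2) with hG2
  have hG1pos : 0 < G1 := one_pos.trans_le (one_le_barrierDeriv n hs0)
  have hdu : Differentiable ℝ u := hu1.differentiable (by simp)
  have hfd : fderiv ℝ u x = (δ * (2 * G1)) • innerSL ℝ (x - x₀) := by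
    have h := hmax.hasFDerivAt_eq_zero ((hdu x).hasFDerivAt.sub
      ((hasFDerivAt_radial (hasDerivAt_barrier n hs0)).const_mul δ))
    rw [sub_eq_zero] at h
    rw [h, smul_smul]
  have hgrad : gradient u x = (δ * (2 * G1)) • (x - x₀) := by
    apply (InnerProductSpace.toDual ℝ (EuclideanSpace ℝ (Fin n))).injective
    rw [toDual_gradient, hfd]
    ext v
    simp
  have hgn : ‖gradient u x‖ = 2 * δ * G1 * r := by
    rw [hgrad, norm_smul, Real.norm_of_nonneg (by positivity), ← hr]
    ring
  have hg0 : gradient u x ≠ 0 := by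
    rw [← norm_pos_iff, hgn]
    positivity
  have hopen : IsOpen {x | gradient u x ≠ 0} := by
    have : Continuous (gradient u) :=
      (InnerProductSpace.toDual ℝ (EuclideanSpace ℝ (Fin n))).symm.continuous.comp
        (hu1.continuous_fderiv (by simp))
    exact isOpen_ne_fun this continuous_const
  have hu2 : ContDiffAt ℝ 2 u x :=
    (hu3.contDiffAt (hopen.mem_nhds hg0)).of_le (by norm_num)
  have hdd : DifferentiableAt ℝ (fderiv ℝ u) x :=
    (hu2.fderiv_right (m := 1) (by norm_num)).differentiableAt (by simp)
  set H := fderiv ℝ (fderiv ℝ u) x with hH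
  let e : Fin n → EuclideanSpace ℝ (Fin n) := fun i => EuclideanSpace.single i 1
  have hpd2 : ∀ i j, pd2 u i j x = H (e i) (e j) := fun i j => by
    have : HasFDerivAt (pd1 u j) (H.flip (e j)) x := by
      have := hdd.hasFDerivAt.clm_apply (hasFDerivAt_const (e j) x)
      refine this.congr_fderiv ?_
      ext v
      simp [H]
    rw [pd2, this.fderiv]
    rfl
  set y : Fin n → ℝ := fun i => (x - x₀) i with hy
  have hysum : ∑ k, y k ^ 2 = r ^ 2 := by
    rw [hr, EuclideanSpace.real_norm_sq_eq]
  have hpd1 : ∀ i, pd1 u i x = 2 * δ * G1 * y i := fun i => by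
    rw [pd1_eq_gradient i, hgrad, hy]
    simp only [PiLp.smul_apply, smul_eq_mul]
    ring
  have hpsum : ∑ k, pd1 u k x ^ 2 = ‖gradient u x‖ ^ 2 := by
    simp only [hpd1, hgn, mul_pow, ← Finset.mul_sum, hysum]
  have hess := hessian_le_of_isLocalMax (G' := barrierDeriv n) (g := G2) hu2
    ((eventually_gt_nhds hs0).mono fun s hs => hasDerivAt_barrier n hs)
    (hasDerivAt_barrierDeriv n hs0) hmax
  let Q : Fin n → Fin n → ℝ := fun i j =>
    δ * (4 * G2 * (y i * y j) + 2 * G1 * (if i = j then 1 else 0))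
  have hneg := sum_coef_mul_nonpos (fun i j => pd2 u i j x - Q i j) (fun i => pd1 u i x) ?_
  · rw [hpsum] at hneg
    have hsplit : mcOp u x ≤ ∑ i, ∑ j, aCoef u i j x * Q i j := by
      simp only [mul_sub, Finset.sum_sub_distrib] at hneg
      simpa only [mcOp, aCoef, sub_nonpos] using hneg
    have hD : 0 < 1 + ‖gradient u x‖ ^ 2 := by positivity
    have e1 : ∑ i, ∑ j, aCoef u i j x * Q i j =
        δ * (2 * ((n : ℝ) - 1) * G1 + (2 * G1 + 4 * G2 * r ^ 2) / (1 + (2 * δ * G1 * r) ^ 2)) := by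
      rw [← hgn]
      set D := 1 + ‖gradient u x‖ ^ 2 with hDdef
      have hin : ∀ i, ∑ j, aCoef u i j x * Q i j = δ * 2 * G1 +
          (δ * 4 * G2 - (2 * δ * G1) ^ 2 * δ / D * (4 * G2 * r ^ 2 + 2 * G1)) * y i ^ 2 := by
        intro i
        have : ∀ j, aCoef u i j x * Q i j =
            (if i = j then δ * (4 * G2 * (y i * y j) + 2 * G1)
              - (2 * δ * G1) ^ 2 * δ / D * (y i * y j) * (2 * G1) else 0)
            - (2 * δ * G1) ^ 2 * δ / D * (4 * G2) * y i ^ 2 * y j ^ 2 := by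
          intro j
          simp only [aCoef, Q, hpd1, ← hDdef]
          split_ifs <;> ring
        simp only [this, Finset.sum_sub_distrib, Finset.sum_ite_eq, Finset.mem_univ, if_true,
          ← Finset.mul_sum, hysum]
        ring
      simp only [hin, Finset.sum_add_distrib, ← Finset.mul_sum, hysum, Finset.sum_const,
        Finset.card_univ, Fintype.card_fin, nsmul_eq_mul]
      have hD' : D = 1 + (2 * δ * G1 * r) ^ 2 := by rw [hDdef, hgn]
      field_simp
      rw [hD']
      ring
    have hstrict := barrier_strict_supersolution hn hρ hδ hδρ hx
    rw [heq x hg0, e1, hgn] at hsplit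
    have := mul_lt_mul_of_pos_left hstrict hδ
    linarith
  · intro i j a b
    have h := hess (a • e i + b • e j)
    have hin : inner ℝ (x - x₀) (a • e i + b • e j) = a * y i + b * y j := by
      simp [e, hy, inner_add_right, inner_smul_right, EuclideanSpace.inner_single_right]
    have hnorm : ‖a • e i + b • e j‖ ^ 2 = a ^ 2 + 2 * (a * b * (if i = j then 1 else 0)) + b ^ 2 := by
      rw [@norm_add_sq_real]
      simp [e, norm_smul, inner_smul_left, inner_smul_right, EuclideanSpace.inner_single_left,
        mul_comm b a]
    rw [hin, hnorm] at h
    simp only [map_add, map_smul, add_apply, smul_apply,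
      smul_eq_mul] at h
    simp only [hpd2, Q, if_true, eq_comm (a := j) (b := i)]
    linarith

/-- Comparison with the radial barrier outside a ball. -/
lemma le_add_barrier (hn : 1 ≤ n) {u : EuclideanSpace ℝ (Fin n) → ℝ}
    (hu1 : ContDiff ℝ 1 u) (hu3 : ContDiffOn ℝ 3 u {x | gradient u x ≠ 0})
    (heq : ∀ x, gradient u x ≠ 0 → mcOp u x = ‖gradient u x‖)
    (hgrowth : ∀ᶠ x in cocompact (EuclideanSpace ℝ (Fin n)), |u x| ≤ ‖x‖)
    {x₀ x : EuclideanSpace ℝ (Fin n)} {ρ δ M : ℝ} (hρ : 0 < ρ) (hδ : 0 < δ)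
    (hδρ : 2 * δ * barrierDeriv n (ρ ^ 2) * (n + 1) ≤ 1)
    (hM : ∀ z, ‖z - x₀‖ = ρ → u z ≤ M) (hx : ρ ≤ ‖x - x₀‖) :
    u x ≤ M + δ * (barrier n (‖x - x₀‖ ^ 2) - barrier n (ρ ^ 2)) := by
  by_contra! hlt
  set w : EuclideanSpace ℝ (Fin n) → ℝ := fun z => u z - δ * barrier n (‖z - x₀‖ ^ 2) with hw
  set K : Set (EuclideanSpace ℝ (Fin n)) := {z | ρ ≤ ‖z - x₀‖} with hK
  have hKc : IsClosed K := isClosed_le continuous_const (by fun_prop)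
  have hwc : ContinuousOn w K := by
    intro z hz
    have hz0 : 0 < ‖z - x₀‖ ^ 2 := pow_pos (hρ.trans_le hz) 2
    exact (hu1.continuous.continuousAt.sub ((hasFDerivAt_radial
      (hasDerivAt_barrier n hz0)).continuousAt.const_mul δ)).continuousWithinAt
  set C := ((n : ℝ) + 1) ^ (2 * n + 2) * (ρ ^ 2) ^ (-(n : ℤ)) with hC
  have hbar : ∀ z ∈ K, ‖z - x₀‖ ^ 2 - C ≤ barrier n (‖z - x₀‖ ^ 2) := by
    intro z hz
    have hz' : ρ ≤ ‖z - x₀‖ := hz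
    have : (‖z - x₀‖ ^ 2) ^ (-(n : ℤ)) ≤ (ρ ^ 2) ^ (-(n : ℤ)) := by
      rw [zpow_neg, zpow_neg, zpow_natCast, zpow_natCast]
      gcongr
    rw [barrier, hC]
    gcongr
  have hfar : ∀ᶠ z in cocompact (EuclideanSpace ℝ (Fin n)) ⊓ 𝓟 K, w z ≤ w x := by
    rw [eventually_inf_principal]
    filter_upwards [hgrowth, (tendsto_norm_cocompact_atTop).eventually_ge_atTop
      (‖x₀‖ + max (2 / δ) (‖x₀‖ + δ * C - w x))] with z hz1 hz2 hzK
    have h1 : ‖z‖ ≤ ‖z - x₀‖ + ‖x₀‖ := by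
      simpa using norm_add_le (z - x₀) x₀
    have h2 : 2 / δ ≤ ‖z - x₀‖ := by linarith [le_max_left (2 / δ) (‖x₀‖ + δ * C - w x)]
    have h3 : ‖x₀‖ + δ * C - w x ≤ ‖z - x₀‖ := by
      linarith [le_max_right (2 / δ) (‖x₀‖ + δ * C - w x)]
    rw [div_le_iff₀ hδ] at h2
    have h4 : w z ≤ ‖z‖ - δ * (‖z - x₀‖ ^ 2 - C) :=
      sub_le_sub ((le_abs_self _).trans hz1) (mul_le_mul_of_nonneg_left (hbar z hzK) hδ.le)
    nlinarith [mul_le_mul_of_nonneg_right h2 (norm_nonneg (z - x₀))]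
  obtain ⟨z, hzK, hzmax⟩ := hwc.exists_isMaxOn' hKc (show x ∈ K from hx) hfar
  have hwz : w x ≤ w z := hzmax hx
  have hzρ : ρ < ‖z - x₀‖ := by
    refine lt_of_le_of_ne hzK fun h => ?_
    have := hM z h.symm
    simp only [hw, ← h] at hwz
    linarith
  refine not_isLocalMax_sub_barrier hn hu1 hu3 heq hρ hδ hδρ hzK (hzmax.isLocalMax ?_)
  have hcont : Continuous fun y : EuclideanSpace ℝ (Fin n) => ‖y - x₀‖ := by fun_prop
  exact (hcont.tendsto z).eventually_const_le hzρ

/-- A solution of at most linear growth attains its maximum at every point. -/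
lemma le_of_solution (hn : 1 ≤ n) {u : EuclideanSpace ℝ (Fin n) → ℝ}
    (hu1 : ContDiff ℝ 1 u) (hu3 : ContDiffOn ℝ 3 u {x | gradient u x ≠ 0})
    (heq : ∀ x, gradient u x ≠ 0 → mcOp u x = ‖gradient u x‖)
    (hgrowth : ∀ᶠ x in cocompact (EuclideanSpace ℝ (Fin n)), |u x| ≤ ‖x‖)
    (x₀ x : EuclideanSpace ℝ (Fin n)) : u x ≤ u x₀ := by
  rcases eq_or_ne x x₀ with rfl | hne
  · exact le_rfl
  have hpos : 0 < ‖x - x₀‖ := norm_pos_iff.2 (sub_ne_zero.2 hne)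
  refine le_of_forall_pos_le_add fun ε hε => ?_
  obtain ⟨ρ₁, hρ₁, hball⟩ := Metric.continuousAt_iff.1
    (hu1.continuous.continuousAt (x := x₀)) ε hε
  set ρ := min (ρ₁ / 2) ‖x - x₀‖ with hρdef
  have hρ : 0 < ρ := lt_min (by positivity) hpos
  have hM : ∀ z, ‖z - x₀‖ = ρ → u z ≤ u x₀ + ε := by
    intro z hz
    have hd : dist z x₀ < ρ₁ := by
      rw [dist_eq_norm, hz]
      linarith [min_le_left (ρ₁ / 2) ‖x - x₀‖]
    have := abs_lt.1 (Real.dist_eq (u z) (u x₀) ▸ hball hd)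
    linarith
  refine le_of_forall_pos_le_add fun η hη => ?_
  set b := barrierDeriv n (ρ ^ 2) with hb
  have hb0 : 0 < b := one_pos.trans_le (one_le_barrierDeriv n (by positivity))
  set k := barrier n (‖x - x₀‖ ^ 2) - barrier n (ρ ^ 2) with hk
  have hden : 0 < 2 * b * (n + 1) := by positivity
  set δ := min (1 / (2 * b * (n + 1))) (η / (|k| + 1)) with hδdef
  have hδ : 0 < δ := lt_min (by positivity) (by positivity)
  have hδ1 : δ * (2 * b * (n + 1)) ≤ 1 := (le_div_iff₀ hden).1 (min_le_left _ _)
  have hδ2 : δ * (|k| + 1) ≤ η := (le_div_iff₀ (by positivity)).1 (min_le_right _ _)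
  have := le_add_barrier hn hu1 hu3 heq hgrowth hρ hδ (by rw [← hb]; linarith) hM
    (min_le_right (ρ₁ / 2) ‖x - x₀‖)
  nlinarith [le_abs_self k]

end

/-- Liouville theorem (E4): entire solutions of
`div(∇u/√(1+|∇u|²)) = |∇u|/√(1+|∇u|²)` growing like `o(|x|^{1/3})` are constant. -/
theorem liouville_E4 (n : ℕ) (hn : 1 ≤ n)
    (u : EuclideanSpace ℝ (Fin n) → ℝ)
    (hu1 : ContDiff ℝ 1 u)
    (hu3 : ContDiffOn ℝ 3 u {x | gradient u x ≠ 0})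
    (heq : ∀ x : EuclideanSpace ℝ (Fin n), gradient u x ≠ 0 →
      mcOp u x = Real.sqrt (1 + ‖gradient u x‖ ^ 2) *
        (‖gradient u x‖ / Real.sqrt (1 + ‖gradient u x‖ ^ 2)))
    (hgrowth : Filter.Tendsto
      (fun x : EuclideanSpace ℝ (Fin n) => |u x| / ‖x‖ ^ ((1 : ℝ) / 3))
      (Filter.cocompact _) (nhds 0)) :
    ∃ c : ℝ, ∀ x, u x = c := by
  have heq' : ∀ x, gradient u x ≠ 0 → mcOp u x = ‖gradient u x‖ := fun x hx => by
    rw [heq x hx, mul_div_cancel₀]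
    positivity
  have hgrowth' : ∀ᶠ x in cocompact (EuclideanSpace ℝ (Fin n)), |u x| ≤ ‖x‖ := by
    filter_upwards [hgrowth.eventually_lt_const one_pos,
      tendsto_norm_cocompact_atTop.eventually_ge_atTop 1] with x h1 h2
    rw [div_lt_one (Real.rpow_pos_of_pos (by linarith) _)] at h1
    refine h1.le.trans ?_
    simpa using Real.rpow_le_rpow_of_exponent_le h2 (by norm_num : (1 : ℝ) / 3 ≤ 1)
  have hle := le_of_solution hn hu1 hu3 heq' hgrowth'
  exact ⟨u 0, fun x => le_antisymm (hle 0 x) (hle x 0)⟩
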